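/- Let N be a norm on the space of real m×n matrices, θ > 0, A a nonzero m×n real matrix, and let N_θ(X) = N(X) + θ‖X‖₁ with dual norm N_θ*. Let X be feasible for the problem min{ N(X) + θ‖X‖₁ : ⟨A, X⟩ ≥ 1 }, i.e., ⟨A, X⟩ ≥ 1. Suppose there exist matrices Y, Z and scalars α, β ≥ 0 such that: (i) Y + Z = A and N*(Y) = θ⁻¹‖Z‖_∞; (ii) X = αG for some subgradient G of N* at Y; (iii) X = βH for some subgradient H of the function ‖·‖_∞ at Z; (iv) α + θβ = (N_θ*(A))⁻¹. Then X is an optimal solution of the problem. If, in addition, (v) N* is differentiable at Y or ‖·‖_∞ is differentiable at Z, then X is the unique optimal solution. -/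

import Mathlib

open Matrix

noncomputable section

attribute [local instance] Matrix.normedAddCommGroup Matrix.normedSpace

/-- The Frobenius (trace) inner product of two real `m × n` matrices. -/
def fip {m n : ℕ} (A X : Matrix (Fin m) (Fin n) ℝ) : ℝ := (Aᵀ * X).trace

/-- `N` is a norm on the space of real `m × n` matrices. -/
structure IsMatrixNorm {m n : ℕ} (N : Matrix (Fin m) (Fin n) ℝ → ℝ) : Prop where
  nonneg : ∀ X, 0 ≤ N X
  definite : ∀ X, N X = 0 → X = 0
  smul : ∀ (c : ℝ) (X), N (c • X) = |c| * N X
  triangle : ∀ X Y, N (X + Y) ≤ N X + N Y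

/-- The dual norm `N*(A) = sup { ⟨A, Y⟩ : N(Y) ≤ 1 }`. -/
def dualNorm {m n : ℕ} (N : Matrix (Fin m) (Fin n) ℝ → ℝ)
    (A : Matrix (Fin m) (Fin n) ℝ) : ℝ :=
  sSup {r | ∃ Y, N Y ≤ 1 ∧ r = fip A Y}

/-- `‖X‖₁`: the sum of the absolute values of all entries of `X`. -/
def l1Norm {m n : ℕ} (X : Matrix (Fin m) (Fin n) ℝ) : ℝ := ∑ i, ∑ j, |X i j|

/-- `‖X‖_∞`: the maximum absolute value of the entries of `X`. -/
def linfNorm {m n : ℕ} (X : Matrix (Fin m) (Fin n) ℝ) : ℝ := ⨆ i, ⨆ j, |X i j|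

/-- The subdifferential of `f : ℝ^{m×n} → ℝ` at `X`, with respect to the Frobenius
inner product. -/
def msubdiff {m n : ℕ} (f : Matrix (Fin m) (Fin n) ℝ → ℝ)
    (X : Matrix (Fin m) (Fin n) ℝ) : Set (Matrix (Fin m) (Fin n) ℝ) :=
  {G | ∀ Y, f X + fip G (Y - X) ≤ f Y}

section FrobeniusPairing

variable {m n : ℕ}

theorem fip_eq_sum (A X : Matrix (Fin m) (Fin n) ℝ) :
    fip A X = ∑ i, ∑ j, A i j * X i j := by
  simp only [fip, Matrix.trace, Matrix.diag, Matrix.mul_apply, Matrix.transpose_apply]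
  exact Finset.sum_comm

theorem fip_comm (A X : Matrix (Fin m) (Fin n) ℝ) : fip A X = fip X A := by
  simp only [fip_eq_sum, mul_comm]

theorem fip_add_right (A X Y : Matrix (Fin m) (Fin n) ℝ) :
    fip A (X + Y) = fip A X + fip A Y := by
  simp [fip, Matrix.mul_add]

theorem fip_smul_right (A X : Matrix (Fin m) (Fin n) ℝ) (c : ℝ) :
    fip A (c • X) = c * fip A X := by
  simp [fip]

theorem fip_add_left (A B X : Matrix (Fin m) (Fin n) ℝ) :
    fip (A + B) X = fip A X + fip B X := by
  simp [fip, Matrix.add_mul]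

theorem fip_smul_left (A X : Matrix (Fin m) (Fin n) ℝ) (c : ℝ) :
    fip (c • A) X = c * fip A X := by
  simp [fip]

theorem fip_sub_right (A X Y : Matrix (Fin m) (Fin n) ℝ) :
    fip A (X - Y) = fip A X - fip A Y := by
  simp [fip, Matrix.mul_sub]

theorem fip_zero_left (X : Matrix (Fin m) (Fin n) ℝ) : fip 0 X = 0 := by
  simp [fip]

theorem fip_zero_right (A : Matrix (Fin m) (Fin n) ℝ) : fip A 0 = 0 := by
  simp [fip]

/-- The linear functional `X ↦ ⟨A, X⟩`. -/
def fipLinear (A : Matrix (Fin m) (Fin n) ℝ) : Matrix (Fin m) (Fin n) ℝ →ₗ[ℝ] ℝ where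
  toFun := fip A
  map_add' := fip_add_right A
  map_smul' c X := fip_smul_right A X c

theorem fip_single (A : Matrix (Fin m) (Fin n) ℝ) (i : Fin m) (j : Fin n) :
    fip A (Matrix.single i j 1) = A i j := by
  simp [fip_eq_sum, Matrix.single_apply, ite_and]

theorem eq_of_fip_eq {A B : Matrix (Fin m) (Fin n) ℝ} (h : ∀ X, fip A X = fip B X) :
    A = B := by
  ext i j
  rw [← fip_single A, h, fip_single]

/-- Every linear functional is represented by the Frobenius pairing. -/
theorem exists_fip_eq (g : Matrix (Fin m) (Fin n) ℝ →ₗ[ℝ] ℝ) :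
    ∃ W, ∀ X, g X = fip W X := by
  refine ⟨Matrix.of fun i j => g (Matrix.single i j 1), fun X => ?_⟩
  conv_lhs => rw [Matrix.matrix_eq_sum_single X]
  simp only [map_sum, fip_eq_sum, Matrix.of_apply]
  refine Finset.sum_congr rfl fun i _ => Finset.sum_congr rfl fun j _ => ?_
  rw [mul_comm, ← smul_eq_mul, ← map_smul, Matrix.smul_single, smul_eq_mul, mul_one]

end FrobeniusPairing

/-- A linear functional on a finite-dimensional space is bounded with respect to any norm. -/
theorem exists_le_mul_norm {E : Type*} [AddCommGroup E] [Module ℝ E] [FiniteDimensional ℝ E]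
    (N : E → ℝ) (nonneg : ∀ x, 0 ≤ N x) (definite : ∀ x, N x = 0 → x = 0)
    (smul : ∀ (c : ℝ) x, N (c • x) = |c| * N x) (triangle : ∀ x y, N (x + y) ≤ N x + N y)
    (f : E →ₗ[ℝ] ℝ) : ∃ C, 0 ≤ C ∧ ∀ x, f x ≤ C * N x := by
  let _ : Norm E := ⟨N⟩
  have core : NormedSpace.Core ℝ E :=
    { norm_nonneg := nonneg
      norm_smul := smul
      norm_triangle := triangle
      norm_eq_zero_iff := fun x =>
        ⟨definite x, fun h => by
          change N x = 0
          simpa [h] using smul 0 (0 : E)⟩ }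
  let _ : NormedAddCommGroup E := NormedAddCommGroup.ofCore core
  let _ : NormedSpace ℝ E := NormedSpace.ofCore core
  let F : E →L[ℝ] ℝ := LinearMap.toContinuousLinearMap f
  exact ⟨‖F‖, norm_nonneg F, fun x => (le_abs_self _).trans (F.le_opNorm x)⟩

namespace IsMatrixNorm

variable {m n : ℕ} {N : Matrix (Fin m) (Fin n) ℝ → ℝ}

theorem map_zero (hN : IsMatrixNorm N) : N 0 = 0 := by
  simpa using hN.smul 0 0

theorem pos (hN : IsMatrixNorm N) {X : Matrix (Fin m) (Fin n) ℝ} (hX : X ≠ 0) : 0 < N X :=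
  (hN.nonneg X).lt_of_ne' fun h => hX (hN.definite X h)

theorem bddAbove (hN : IsMatrixNorm N) (A : Matrix (Fin m) (Fin n) ℝ) :
    BddAbove {r | ∃ Y, N Y ≤ 1 ∧ r = fip A Y} := by
  obtain ⟨C, hC, h⟩ :=
    exists_le_mul_norm N hN.nonneg hN.definite hN.smul hN.triangle (fipLinear A)
  refine ⟨C, ?_⟩
  rintro r ⟨Y, hY, rfl⟩
  exact (h Y).trans (mul_le_of_le_one_right hC hY)

theorem fip_le_dualNorm (hN : IsMatrixNorm N) {X : Matrix (Fin m) (Fin n) ℝ} (hX : N X ≤ 1)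
    (A : Matrix (Fin m) (Fin n) ℝ) : fip A X ≤ dualNorm N A :=
  le_csSup (hN.bddAbove A) ⟨X, hX, rfl⟩

theorem dualNorm_le (hN : IsMatrixNorm N) {A : Matrix (Fin m) (Fin n) ℝ} {c : ℝ}
    (h : ∀ X, N X ≤ 1 → fip A X ≤ c) : dualNorm N A ≤ c := by
  refine csSup_le ⟨_, 0, by simp [hN.map_zero], rfl⟩ ?_
  rintro r ⟨X, hX, rfl⟩
  exact h X hX

theorem fip_le_mul (hN : IsMatrixNorm N) (A X : Matrix (Fin m) (Fin n) ℝ) :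
    fip A X ≤ dualNorm N A * N X := by
  by_cases hX : X = 0
  · simp [hX, fip_zero_right, hN.map_zero]
  have hp := hN.pos hX
  have h := hN.fip_le_dualNorm (X := (N X)⁻¹ • X)
    (by rw [hN.smul, abs_of_pos (inv_pos.2 hp), inv_mul_cancel₀ hp.ne']) A
  rwa [fip_smul_right, inv_mul_le_iff₀ hp, mul_comm] at h

theorem dualNorm_zero_le (hN : IsMatrixNorm N) : dualNorm N 0 ≤ 0 :=
  hN.dualNorm_le fun X _ => (fip_zero_left X).le

theorem dualNorm_two_smul_le (hN : IsMatrixNorm N) (A : Matrix (Fin m) (Fin n) ℝ) :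
    dualNorm N ((2 : ℝ) • A) ≤ 2 * dualNorm N A :=
  hN.dualNorm_le fun X hX => by
    rw [fip_smul_left]
    linarith [hN.fip_le_dualNorm hX A]

/-- A matrix in the polar of the dual unit ball lies in the unit ball. -/
theorem le_one_of_fip_le_dualNorm (hN : IsMatrixNorm N) {G : Matrix (Fin m) (Fin n) ℝ}
    (hG : ∀ W, fip G W ≤ dualNorm N W) : N G ≤ 1 := by
  by_cases hG0 : G = 0
  · simp [hG0, hN.map_zero]
  let f : Matrix (Fin m) (Fin n) ℝ →ₗ.[ℝ] ℝ := LinearPMap.mkSpanSingleton G (N G) hG0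
  obtain ⟨g, hgf, hgN⟩ := exists_extension_of_le_sublinear f N
    (fun c hc X => by rw [hN.smul, abs_of_pos hc]) hN.triangle (by
      rintro ⟨x, hx⟩
      obtain ⟨c, rfl⟩ := Submodule.mem_span_singleton.1 hx
      rw [LinearPMap.mkSpanSingleton'_apply, hN.smul, smul_eq_mul]
      exact mul_le_mul_of_nonneg_right (le_abs_self c) (hN.nonneg G))
  have hgG : g G = N G := by
    have h := hgf ⟨G, Submodule.mem_span_singleton_self G⟩
    rw [LinearPMap.mkSpanSingleton_apply] at h
    exact h
  obtain ⟨W, hW⟩ := exists_fip_eq g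
  calc N G = fip G W := by rw [← hgG, hW, fip_comm]
    _ ≤ dualNorm N W := hG W
    _ ≤ 1 := hN.dualNorm_le fun X hX => by rw [← hW]; exact (hgN X).trans hX

end IsMatrixNorm

section EntrywiseNorms

variable {m n : ℕ}

theorem abs_le_linfNorm (X : Matrix (Fin m) (Fin n) ℝ) (i : Fin m) (j : Fin n) :
    |X i j| ≤ linfNorm X :=
  (le_ciSup (f := fun j => |X i j|) (Set.finite_range _).bddAbove j).trans
    (le_ciSup (f := fun i => ⨆ j, |X i j|) (Set.finite_range _).bddAbove i)

theorem linfNorm_le {X : Matrix (Fin m) (Fin n) ℝ} {c : ℝ} (hc : 0 ≤ c)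
    (h : ∀ i j, |X i j| ≤ c) : linfNorm X ≤ c :=
  Real.iSup_le (fun i => Real.iSup_le (h i) hc) hc

theorem linfNorm_nonneg (X : Matrix (Fin m) (Fin n) ℝ) : 0 ≤ linfNorm X :=
  Real.iSup_nonneg fun _ => Real.iSup_nonneg fun _ => abs_nonneg _

theorem linfNorm_two_smul_le (X : Matrix (Fin m) (Fin n) ℝ) :
    linfNorm ((2 : ℝ) • X) ≤ 2 * linfNorm X :=
  linfNorm_le (mul_nonneg zero_le_two (linfNorm_nonneg X)) fun i j => by
    simpa [abs_mul] using abs_le_linfNorm X i j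

theorem linfNorm_zero_le : linfNorm (0 : Matrix (Fin m) (Fin n) ℝ) ≤ 0 :=
  linfNorm_le le_rfl fun i j => by simp

theorem isMatrixNorm_l1Norm : IsMatrixNorm (l1Norm (m := m) (n := n)) where
  nonneg X := Finset.sum_nonneg fun i _ => Finset.sum_nonneg fun j _ => abs_nonneg _
  definite X h := by
    ext i j
    rw [l1Norm, Finset.sum_eq_zero_iff_of_nonneg
      fun i _ => Finset.sum_nonneg fun j _ => abs_nonneg _] at h
    have hi := h i (Finset.mem_univ i)
    rw [Finset.sum_eq_zero_iff_of_nonneg fun j _ => abs_nonneg _] at hi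
    exact abs_eq_zero.1 (hi j (Finset.mem_univ j))
  smul c X := by simp [l1Norm, abs_mul, Finset.mul_sum]
  triangle X Y := by
    simp only [l1Norm, ← Finset.sum_add_distrib]
    exact Finset.sum_le_sum fun i _ => Finset.sum_le_sum fun j _ => abs_add_le _ _

theorem fip_le_linfNorm_mul_l1Norm (A X : Matrix (Fin m) (Fin n) ℝ) :
    fip A X ≤ linfNorm A * l1Norm X := by
  simp only [fip_eq_sum, l1Norm, Finset.mul_sum]
  refine Finset.sum_le_sum fun i _ => Finset.sum_le_sum fun j _ => ?_
  calc A i j * X i j ≤ |A i j| * |X i j| := by rw [← abs_mul]; exact le_abs_self _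
    _ ≤ linfNorm A * |X i j| :=
      mul_le_mul_of_nonneg_right (abs_le_linfNorm A i j) (abs_nonneg _)

theorem l1Norm_le_one_of_fip_le_linfNorm {H : Matrix (Fin m) (Fin n) ℝ}
    (hH : ∀ W, fip H W ≤ linfNorm W) : l1Norm H ≤ 1 := by
  have h := hH (Matrix.of fun i j => (SignType.sign (H i j) : ℝ))
  simp only [fip_eq_sum, Matrix.of_apply, self_mul_sign] at h
  refine h.trans (linfNorm_le zero_le_one fun i j => ?_)
  rcases lt_trichotomy (H i j) 0 with h0 | h0 | h0 <;> simp [h0]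

end EntrywiseNorms

theorem IsMatrixNorm.add_mul_l1Norm {m n : ℕ} {N : Matrix (Fin m) (Fin n) ℝ → ℝ}
    (hN : IsMatrixNorm N) {θ : ℝ} (hθ : 0 ≤ θ) :
    IsMatrixNorm (fun W => N W + θ * l1Norm W) where
  nonneg X := add_nonneg (hN.nonneg X) (mul_nonneg hθ (isMatrixNorm_l1Norm.nonneg X))
  definite X h := hN.definite X <|
    le_antisymm (by linarith [mul_nonneg hθ (isMatrixNorm_l1Norm.nonneg X)]) (hN.nonneg X)
  smul c X := by
    simp only [hN.smul, isMatrixNorm_l1Norm.smul]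
    ring
  triangle X Y := by
    linarith [hN.triangle X Y, mul_le_mul_of_nonneg_left (isMatrixNorm_l1Norm.triangle X Y) hθ]

section Subdifferential

variable {m n : ℕ} {f : Matrix (Fin m) (Fin n) ℝ → ℝ} {Y G : Matrix (Fin m) (Fin n) ℝ}

theorem fip_eq_of_mem_msubdiff (h0 : f 0 ≤ 0) (h2 : f ((2 : ℝ) • Y) ≤ 2 * f Y)
    (hG : G ∈ msubdiff f Y) : fip G Y = f Y := by
  have ha := hG 0
  have hb := hG ((2 : ℝ) • Y)
  rw [fip_sub_right, fip_zero_right] at ha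
  rw [fip_sub_right, fip_smul_right] at hb
  linarith

theorem fip_le_of_mem_msubdiff (h0 : f 0 ≤ 0) (h2 : f ((2 : ℝ) • Y) ≤ 2 * f Y)
    (hG : G ∈ msubdiff f Y) (W : Matrix (Fin m) (Fin n) ℝ) : fip G W ≤ f W := by
  have h := hG W
  rw [fip_sub_right, fip_eq_of_mem_msubdiff h0 h2 hG] at h
  linarith

theorem fderiv_eq_of_mem_msubdiff (hf : DifferentiableAt ℝ f Y) (hG : G ∈ msubdiff f Y)
    (W : Matrix (Fin m) (Fin n) ℝ) : fderiv ℝ f Y W = fip G W := by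
  let L : Matrix (Fin m) (Fin n) ℝ →L[ℝ] ℝ := LinearMap.toContinuousLinearMap (fipLinear G)
  have hmin : IsLocalMin (fun V => f V - L V) Y := Filter.Eventually.of_forall fun V => by
    have h := hG V
    rw [fip_sub_right] at h
    change f Y - fip G Y ≤ f V - fip G V
    linarith
  have hd := hmin.hasFDerivAt_eq_zero (hf.hasFDerivAt.sub L.hasFDerivAt)
  rw [sub_eq_zero.1 hd]
  rfl

theorem msubdiff_subsingleton (hf : DifferentiableAt ℝ f Y) : (msubdiff f Y).Subsingleton :=
  fun _ hG _ hG' => eq_of_fip_eq fun W => by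
    rw [← fderiv_eq_of_mem_msubdiff hf hG, fderiv_eq_of_mem_msubdiff hf hG']

theorem inv_smul_mem_msubdiff {g : Matrix (Fin m) (Fin n) ℝ → ℝ}
    (hfg : ∀ V W, fip V W ≤ f V * g W) {X : Matrix (Fin m) (Fin n) ℝ} (hX : 0 < g X)
    (h : fip Y X = f Y * g X) : (g X)⁻¹ • X ∈ msubdiff f Y := by
  intro V
  rw [fip_sub_right, fip_smul_left, fip_smul_left, fip_comm X V, fip_comm X Y, h,
    mul_comm (f Y), inv_mul_cancel_left₀ hX.ne']
  have := (inv_mul_le_iff₀ hX).2 ((hfg V X).trans_eq (mul_comm _ _))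
  linarith

/-- If the dual function `f` is differentiable at `Y`, a normalized matrix attaining the duality
bound is determined up to the multiple of the unique subgradient. -/
theorem eq_of_differentiableAt {g : Matrix (Fin m) (Fin n) ℝ → ℝ}
    (hfg : ∀ V W, fip V W ≤ f V * g W) (hf : DifferentiableAt ℝ f Y) (hG : G ∈ msubdiff f Y)
    {A X X' : Matrix (Fin m) (Fin n) ℝ} {c : ℝ} (hX : X = c • G) (hX' : 0 < g X')
    (h : fip Y X' = f Y * g X') (hA : fip A X = 1) (hA' : fip A X' = 1) : X' = X := by
  have hG' := msubdiff_subsingleton hf (inv_smul_mem_msubdiff hfg hX' h) hG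
  rw [← hG', smul_smul] at hX
  rw [hX, fip_smul_right, hA', mul_one] at hA
  rw [hX, hA, one_smul]

end Subdifferential

/-- Sufficient optimality (and uniqueness) conditions for
`min { N(X) + θ‖X‖₁ : ⟨A, X⟩ ≥ 1 }`. -/
theorem stmt5 {m n : ℕ} (N : Matrix (Fin m) (Fin n) ℝ → ℝ) (hN : IsMatrixNorm N)
    (θ : ℝ) (hθ : 0 < θ) (A : Matrix (Fin m) (Fin n) ℝ) (hA : A ≠ 0)
    (X : Matrix (Fin m) (Fin n) ℝ) (hfeas : 1 ≤ fip A X)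
    (Y Z : Matrix (Fin m) (Fin n) ℝ) (α β : ℝ) (hα : 0 ≤ α) (hβ : 0 ≤ β)
    (h1 : Y + Z = A) (h1' : dualNorm N Y = θ⁻¹ * linfNorm Z)
    (h2 : ∃ G ∈ msubdiff (dualNorm N) Y, X = α • G)
    (h3 : ∃ H ∈ msubdiff linfNorm Z, X = β • H)
    (h4 : α + θ * β = (dualNorm (fun W => N W + θ * l1Norm W) A)⁻¹) :
    (∀ X', 1 ≤ fip A X' → N X + θ * l1Norm X ≤ N X' + θ * l1Norm X') ∧
      ((DifferentiableAt ℝ (dualNorm N) Y ∨ DifferentiableAt ℝ linfNorm Z) →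
        ∀ X', 1 ≤ fip A X' →
          (∀ X'', 1 ≤ fip A X'' → N X' + θ * l1Norm X' ≤ N X'' + θ * l1Norm X'') →
          X' = X) := by
  set M : Matrix (Fin m) (Fin n) ℝ → ℝ := fun W => N W + θ * l1Norm W
  have hM : IsMatrixNorm M := hN.add_mul_l1Norm hθ.le
  have hM_apply (W) : M W = N W + θ * l1Norm W := rfl
  obtain ⟨G, hG, hXG⟩ := h2
  obtain ⟨H, hH, hXH⟩ := h3
  set s := dualNorm N Y
  set d := dualNorm M A
  have hZ : linfNorm Z = θ * s := by rw [h1', mul_inv_cancel_left₀ hθ.ne']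
  have hYW (W) : fip Y W ≤ s * N W := hN.fip_le_mul Y W
  have hZW (W) : fip Z W ≤ θ * s * l1Norm W := hZ ▸ fip_le_linfNorm_mul_l1Norm Z W
  have hAW (W) : fip A W = fip Y W + fip Z W := by rw [← h1, fip_add_left]
  have hNG : N G ≤ 1 := hN.le_one_of_fip_le_dualNorm <|
    fip_le_of_mem_msubdiff hN.dualNorm_zero_le (hN.dualNorm_two_smul_le Y) hG
  have hH1 : l1Norm H ≤ 1 := l1Norm_le_one_of_fip_le_linfNorm <|
    fip_le_of_mem_msubdiff linfNorm_zero_le (linfNorm_two_smul_le Z) hH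
  have hYX : fip Y X = α * s := by
    rw [hXG, fip_smul_right, fip_comm,
      fip_eq_of_mem_msubdiff hN.dualNorm_zero_le (hN.dualNorm_two_smul_le Y) hG]
  have hZX : fip Z X = β * (θ * s) := by
    rw [hXH, fip_smul_right, fip_comm,
      fip_eq_of_mem_msubdiff linfNorm_zero_le (linfNorm_two_smul_le Z) hH, hZ]
  have hMX : M X ≤ d⁻¹ := by
    have hNX : N X ≤ α := by
      rw [hXG, hN.smul, abs_of_nonneg hα]
      exact mul_le_of_le_one_right hα hNG
    have hlX : l1Norm X ≤ β := by
      rw [hXH, isMatrixNorm_l1Norm.smul, abs_of_nonneg hβ]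
      exact mul_le_of_le_one_right hβ hH1
    rw [← h4, hM_apply]
    linarith [mul_le_mul_of_nonneg_left hlX hθ.le]
  have hdpos : 0 < d := by
    have h := hfeas.trans (hM.fip_le_mul A X)
    exact pos_of_mul_pos_left (zero_lt_one.trans_le h) (hM.nonneg X)
  have hopt (X') (hX' : 1 ≤ fip A X') : M X ≤ M X' :=
    hMX.trans <| (inv_le_iff_one_le_mul₀' hdpos).2 (hX'.trans (hM.fip_le_mul A X'))
  refine ⟨hopt, fun hdiff X' hX' hX'opt => ?_⟩
  have hAX : fip A X = s * d⁻¹ := by rw [hAW, hYX, hZX, ← h4]; ring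
  have hle {W} (hW : M W ≤ d⁻¹) : fip A W ≤ 1 :=
    (hM.fip_le_mul A W).trans <|
      (mul_le_mul_of_nonneg_left hW hdpos.le).trans_eq (mul_inv_cancel₀ hdpos.ne')
  have hAX1 : fip A X = 1 := le_antisymm (hle hMX) hfeas
  have hsd : s = d := by
    rw [hAX1, ← div_eq_mul_inv, eq_div_iff hdpos.ne', one_mul] at hAX
    exact hAX.symm
  have hMX' : M X' ≤ d⁻¹ := (hX'opt X hfeas).trans hMX
  have hAX' : fip A X' = 1 := le_antisymm (hle hMX') hX'
  have hX'0 : X' ≠ 0 := by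
    rintro rfl
    rw [fip_zero_right] at hAX'
    exact zero_ne_one hAX'
  have htight : s * N X' + θ * s * l1Norm X' ≤ fip Y X' + fip Z X' := by
    rw [← hAW, hAX', hsd]
    have h := mul_le_mul_of_nonneg_left hMX' hdpos.le
    rw [mul_inv_cancel₀ hdpos.ne', hM_apply] at h
    linarith
  rcases hdiff with hdiff | hdiff
  · exact eq_of_differentiableAt hN.fip_le_mul hdiff hG hXG (hN.pos hX'0)
      (le_antisymm (hYW X') (by linarith [hZW X'])) hAX1 hAX'
  · refine eq_of_differentiableAt fip_le_linfNorm_mul_l1Norm hdiff hH hXH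
      (isMatrixNorm_l1Norm.pos hX'0) ?_ hAX1 hAX'
    rw [hZ]
    exact le_antisymm (hZW X') (by linarith [hYW X'])
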